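/- Let H be an n×n nonsingular complex Hankel matrix with entries H_{ij} = h_{i+j-1} determined by h_1, ..., h_{2n-1}. For γ ∈ C, let C_γ be the companion matrix whose last row is (h_{n+1}, ..., h_{2n-1}, γ) H^{-1} and whose i-th row is e_{i+1}^T for i = 1, ..., n-1. Then the set of complex numbers γ for which C_γ is not diagonalizable is finite, and has at most 2(n-1) elements. -/

import Mathlib

open Matrix

/-- The `n×n` companion matrix whose rows `1, ..., n-1` are `e_2ᵀ, ..., e_nᵀ` and whose
last row is `(c_0, ..., c_{n-1})`. -/
def companionMat (n : ℕ) (c : Fin n → ℂ) : Matrix (Fin n) (Fin n) ℂ :=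
  Matrix.of fun i j : Fin n =>
    if (i : ℕ) < n - 1 then (if (j : ℕ) = (i : ℕ) + 1 then 1 else 0) else c j

/-- A complex square matrix is diagonalizable if it is similar to a diagonal matrix. -/
def IsDiagonalizableMat {n : ℕ} (A : Matrix (Fin n) (Fin n) ℂ) : Prop :=
  ∃ P : Matrix (Fin n) (Fin n) ℂ, IsUnit P.det ∧
    ∃ d : Fin n → ℂ, A = P * Matrix.diagonal d * P⁻¹

open Polynomial in
/-- The linear functional on polynomials with `X ^ k ↦ h (k + 1)`. -/
noncomputable def momentFunctional (h : ℕ → ℂ) : ℂ[X] →ₗ[ℂ] ℂ :=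
  Polynomial.lsum fun k => h (k + 1) • LinearMap.id

open Polynomial in
/-- The polynomial of degree less than `n` with coefficients `c`. -/
noncomputable def coeffPoly {n : ℕ} (c : Fin n → ℂ) : ℂ[X] :=
  ∑ j, C (c j) * X ^ (j : ℕ)

section Polynomials

open Polynomial

lemma momentFunctional_C_mul_X_pow (h : ℕ → ℂ) (a : ℂ) (k : ℕ) :
    momentFunctional h (C a * X ^ k) = a * h (k + 1) := by
  rw [C_mul_X_pow_eq_monomial, momentFunctional, lsum_apply, sum_monomial_index]
  · simp [mul_comm]
  · simp

lemma momentFunctional_X_pow (h : ℕ → ℂ) (k : ℕ) :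
    momentFunctional h (X ^ k) = h (k + 1) := by
  simpa using momentFunctional_C_mul_X_pow h 1 k

lemma momentFunctional_coeffPoly_mul_X_pow {n : ℕ} (h : ℕ → ℂ) (c : Fin n → ℂ) (k : ℕ) :
    momentFunctional h (coeffPoly c * X ^ k) = ∑ j, c j * h (j + k + 1) := by
  simp only [coeffPoly, Finset.sum_mul, map_sum, mul_assoc, ← pow_add,
    momentFunctional_C_mul_X_pow]

lemma LinearMap.map_mul_eq_zero_of_degree_lt (L : ℂ[X] →ₗ[ℂ] ℂ) {r u : ℂ[X]} {m : ℕ}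
    (hr : ∀ k < m, L (r * X ^ k) = 0) (hu : u.degree < m) : L (r * u) = 0 := by
  rw [u.as_sum_support_C_mul_X_pow, Finset.mul_sum, map_sum]
  refine Finset.sum_eq_zero fun k hk => ?_
  have hkm : k < m := by
    have := (le_degree_of_mem_supp k hk).trans_lt hu
    exact_mod_cast this
  rw [mul_left_comm, C_mul', map_smul, hr k hkm, smul_zero]

lemma degree_coeffPoly_lt {n : ℕ} (c : Fin n → ℂ) : (coeffPoly c).degree < n := by
  refine (degree_sum_le _ _).trans_lt ((Finset.sup_lt_iff (WithBot.bot_lt_coe n)).2 fun j _ => ?_)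
  refine (degree_C_mul_X_pow_le _ _).trans_lt ?_
  exact Nat.cast_lt.2 j.2

lemma monic_X_pow_sub_coeffPoly {n : ℕ} (c : Fin n → ℂ) : (X ^ n - coeffPoly c).Monic :=
  monic_X_pow_sub (degree_coeffPoly_lt c)

lemma natDegree_X_pow_sub_coeffPoly {n : ℕ} (c : Fin n → ℂ) :
    (X ^ n - coeffPoly c).natDegree = n := by
  rw [natDegree_eq_of_degree_eq (degree_sub_eq_left_of_degree_lt _), natDegree_X_pow]
  rw [degree_X_pow]
  exact degree_coeffPoly_lt c

lemma eval_coeffPoly {n : ℕ} (c : Fin n → ℂ) (z : ℂ) :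
    (coeffPoly c).eval z = ∑ j, c j * z ^ (j : ℕ) := by
  simp [coeffPoly, eval_finsetSum]

/-- If the moment functional pairs `p` to zero with all polynomials of degree less than `m`, and
`q` to zero with those but not with `X ^ m`, then `p` and `q` have no common zero. -/
lemma isCoprime_of_moments (L : ℂ[X] →ₗ[ℂ] ℂ) {m : ℕ} {p q : ℂ[X]} (hp : p.Monic)
    (hpdeg : p.natDegree = m + 1) (hqdeg : q.degree < (m + 1 : ℕ))
    (hLp : ∀ k < m, L (p * X ^ k) = 0) (hLq : ∀ k < m, L (q * X ^ k) = 0)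
    (hLq' : L (q * X ^ m) ≠ 0) : IsCoprime p q := by
  rw [isCoprime_iff_aeval_ne_zero_of_isAlgClosed ℂ ℂ]
  intro z
  by_contra! hz
  obtain ⟨⟨v, hv⟩, ⟨u, hu⟩⟩ :=
    And.intro (dvd_iff_isRoot.2 (by simpa using hz.1 : p.IsRoot z))
      (dvd_iff_isRoot.2 (by simpa using hz.2 : q.IsRoot z))
  have hvm : v.Monic := (monic_X_sub_C z).of_mul_monic_left (hv ▸ hp)
  have hvdeg : v.natDegree = m := by
    have := (monic_X_sub_C z).natDegree_mul hvm
    rw [← hv, hpdeg, natDegree_X_sub_C] at this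
    omega
  have hudeg : u.degree < m := by
    rcases eq_or_ne u 0 with rfl | hu0
    · simp
    have hq0 : q ≠ 0 := by
      rw [hu]
      exact mul_ne_zero (X_sub_C_ne_zero z) hu0
    have := natDegree_mul (X_sub_C_ne_zero z) hu0
    rw [← hu, natDegree_X_sub_C] at this
    rw [← natDegree_lt_iff_degree_lt hq0] at hqdeg
    rw [← natDegree_lt_iff_degree_lt hu0]
    omega
  have hpu : L (p * u) = 0 := L.map_mul_eq_zero_of_degree_lt hLp hudeg
  have hsub : (v - X ^ m).degree < (m : WithBot ℕ) := by
    have := degree_sub_lt_left (p := v) (q := X ^ m)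
      (by rw [degree_X_pow, degree_eq_natDegree hvm.ne_zero, hvdeg]) hvm.ne_zero
      (by rw [hvm.leadingCoeff, (monic_X_pow m).leadingCoeff])
    rwa [degree_eq_natDegree hvm.ne_zero, hvdeg] at this
  have hqv : L (q * (v - X ^ m)) = 0 := L.map_mul_eq_zero_of_degree_lt hLq hsub
  rw [mul_sub, map_sub, sub_eq_zero] at hqv
  apply hLq'
  rw [← hqv, ← hpu, hv, hu]
  congr 1
  ring

/-- In a pencil `p - γ q` spanned by coprime polynomials, only few members are inseparable. -/
lemma finite_not_separable_pencil {m : ℕ} {p q : ℂ[X]} (hpq : IsCoprime p q)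
    (hpdeg : p.natDegree = m + 1) (hqdeg : q.natDegree ≤ m) :
    {γ : ℂ | ¬ (p - C γ * q).Separable}.Finite ∧
      {γ : ℂ | ¬ (p - C γ * q).Separable}.ncard ≤ 2 * m := by
  have hW : wronskian p q ≠ 0 := by
    intro h0
    have := derivative_eq_zero.1 (hpq.wronskian_eq_zero_iff.1 h0).1
    omega
  have hWdeg : (wronskian p q).natDegree ≤ 2 * m := by
    have := natDegree_wronskian_lt_add hW
    omega
  have hsub : {γ : ℂ | ¬ (p - C γ * q).Separable} ⊆
      ((wronskian p q).roots.toFinset.image fun z => p.eval z / q.eval z : Finset ℂ) := by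
    intro γ hγ
    rw [Set.mem_ofPred_eq, Separable, isCoprime_iff_aeval_ne_zero_of_isAlgClosed ℂ ℂ] at hγ
    push Not at hγ
    obtain ⟨z, hz, hz'⟩ := hγ
    simp only [coe_aeval_eq_eval, eval_sub, eval_mul, eval_C, derivative_sub, derivative_mul,
      derivative_C, zero_mul, zero_add, sub_eq_zero] at hz hz'
    have hqz : q.eval z ≠ 0 := by
      intro h0
      rcases (isCoprime_iff_aeval_ne_zero_of_isAlgClosed ℂ ℂ p q).1 hpq z with h1 | h1
      · exact h1 (by simp [hz, h0])
      · exact h1 (by simp [h0])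
    simp only [Finset.coe_image, Set.mem_image, Finset.mem_coe, Multiset.mem_toFinset,
      mem_roots hW]
    refine ⟨z, ?_, ?_⟩
    · simp only [IsRoot, wronskian, eval_sub, eval_mul, hz, hz']
      ring
    · rw [hz, mul_div_cancel_right₀ _ hqz]
  refine ⟨(Finset.finite_toSet _).subset hsub, ?_⟩
  calc _ ≤ _ := Set.ncard_le_ncard hsub (Finset.finite_toSet _)
    _ = _ := Set.ncard_coe_finset _
    _ ≤ _ := Finset.card_image_le
    _ ≤ _ := Multiset.toFinset_card_le _
    _ ≤ _ := card_roots' _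
    _ ≤ _ := hWdeg

/-- A companion matrix is diagonalized by the transposed Vandermonde matrix of the roots of its
characteristic polynomial, when these are simple. -/
lemma isDiagonalizableMat_companionMat {n : ℕ} (c : Fin n → ℂ)
    (hc : (X ^ n - coeffPoly c).Separable) : IsDiagonalizableMat (companionMat n c) := by
  have hcard : (X ^ n - coeffPoly c).roots.toFinset.card = n := by
    rw [Multiset.toFinset_card_of_nodup (nodup_roots hc),
      IsAlgClosed.card_roots_eq_natDegree, natDegree_X_pow_sub_coeffPoly]
  let e := (Finset.equivFinOfCardEq hcard).symm
  let z : Fin n → ℂ := fun i => e i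
  have hz : Function.Injective z := Subtype.val_injective.comp e.injective
  have hroot (k : Fin n) : ∑ j, c j * z k ^ (j : ℕ) = z k ^ n := by
    have hk := isRoot_of_mem_roots (Multiset.mem_toFinset.1 (e k).2)
    rw [IsRoot, eval_sub, eval_pow, eval_X, eval_coeffPoly, sub_eq_zero] at hk
    exact hk.symm
  have hdet : IsUnit (vandermonde z)ᵀ.det := by
    rw [det_transpose]
    exact (det_vandermonde_ne_zero_iff.2 hz).isUnit
  refine ⟨(vandermonde z)ᵀ, hdet, z, ?_⟩
  have hmul : companionMat n c * (vandermonde z)ᵀ = (vandermonde z)ᵀ * diagonal z := by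
    ext i k
    rw [mul_diagonal, mul_apply]
    simp only [companionMat, of_apply, transpose_apply, vandermonde_apply, ← pow_succ]
    split_ifs with hi
    · rw [Finset.sum_eq_single (⟨i + 1, by omega⟩ : Fin n)]
      · simp
      · intro j _ hj
        rw [if_neg (fun hji => hj (Fin.ext hji)), zero_mul]
      · simp
    · rw [hroot]
      congr 1
      omega
  rw [← hmul, mul_nonsing_inv_cancel_right _ _ hdet]

end Polynomials

/-- Let `H` be an `n×n` nonsingular complex Hankel matrix.  For `γ ∈ ℂ`, let
`C_γ` be the companion matrix with last row `(h_{n+1}, ..., h_{2n-1}, γ) H⁻¹`.  Then the set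
of `γ` for which `C_γ` is not diagonalizable is finite, with at most `2(n-1)` elements. -/
theorem nondiagonalizable_gammas_finite
    (n : ℕ) (hn : 0 < n) (h : ℕ → ℂ)
    (H : Matrix (Fin n) (Fin n) ℂ)
    (hH : ∀ i j : Fin n, H i j = h ((i : ℕ) + (j : ℕ) + 1))
    (hdet : IsUnit H.det) :
    {γ : ℂ | ¬ IsDiagonalizableMat (companionMat n
        ((fun j : Fin n => if (j : ℕ) = n - 1 then γ else h (n + 1 + (j : ℕ))) ᵥ* H⁻¹))}.Finite ∧
    {γ : ℂ | ¬ IsDiagonalizableMat (companionMat n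
        ((fun j : Fin n => if (j : ℕ) = n - 1 then γ else h (n + 1 + (j : ℕ))) ᵥ* H⁻¹))}.ncard
      ≤ 2 * (n - 1) := by
  open Polynomial in
  obtain ⟨m, rfl⟩ : ∃ m, n = m + 1 := ⟨n - 1, by omega⟩
  simp only [Nat.add_sub_cancel]
  set w : ℂ → Fin (m + 1) → ℂ :=
    fun γ j => if (j : ℕ) = m then γ else h (m + 1 + 1 + (j : ℕ)) with hw
  have hwadd (γ : ℂ) : w γ = w 0 + γ • Pi.single (Fin.last m) 1 := by
    ext j
    by_cases hj : j = Fin.last m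
    · simp [hw, hj]
    · have : (j : ℕ) ≠ m := fun h => hj (Fin.ext h)
      simp [hw, hj, this]
  have hmoment (v : Fin (m + 1) → ℂ) (k : Fin (m + 1)) :
      momentFunctional h (coeffPoly (v ᵥ* H⁻¹) * X ^ (k : ℕ)) = v k := by
    rw [momentFunctional_coeffPoly_mul_X_pow]
    have : ((v ᵥ* H⁻¹) ᵥ* H) k = v k := by
      rw [vecMul_vecMul, nonsing_inv_mul _ hdet, vecMul_one]
    simpa [vecMul, dotProduct, hH] using this
  set p : ℂ[X] := X ^ (m + 1) - coeffPoly (w 0 ᵥ* H⁻¹) with hp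
  set q : ℂ[X] := coeffPoly (Pi.single (Fin.last m) 1 ᵥ* H⁻¹) with hq
  have hpencil (γ : ℂ) : X ^ (m + 1) - coeffPoly (w γ ᵥ* H⁻¹) = p - C γ * q := by
    rw [hwadd, add_vecMul, smul_vecMul, hp, hq]
    simp only [coeffPoly, Pi.add_apply, Pi.smul_apply, smul_eq_mul, C_add, C_mul, add_mul,
      Finset.sum_add_distrib, Finset.mul_sum, mul_assoc]
    ring
  have hpdeg : p.natDegree = m + 1 := natDegree_X_pow_sub_coeffPoly _
  have hqdeg : q.degree < (m + 1 : ℕ) := degree_coeffPoly_lt _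
  have hcop : IsCoprime p q := by
    refine isCoprime_of_moments (momentFunctional h) (monic_X_pow_sub_coeffPoly _) hpdeg hqdeg
      (fun k hk => ?_) (fun k hk => ?_) ?_
    · have := hmoment (w 0) ⟨k, by omega⟩
      rw [hp, sub_mul, map_sub, ← pow_add, momentFunctional_X_pow, this]
      simp only [hw, hk.ne, if_false, sub_eq_zero]
      congr 1
      omega
    · have := hmoment (Pi.single (Fin.last m) 1) ⟨k, by omega⟩
      rw [hq, this, Pi.single_eq_of_ne]
      simp [Fin.ext_iff, hk.ne]
    · have := hmoment (Pi.single (Fin.last m) 1) (Fin.last m)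
      rw [Fin.val_last] at this
      rw [hq, this, Pi.single_eq_same]
      exact one_ne_zero
  have hqnat : q.natDegree ≤ m :=
    natDegree_le_iff_coeff_eq_zero.2 ((degree_lt_iff_coeff_zero q (m + 1)).1 hqdeg)
  obtain ⟨hfin, hcard⟩ := finite_not_separable_pencil hcop hpdeg hqnat
  have hsub : {γ : ℂ | ¬ IsDiagonalizableMat (companionMat (m + 1) (w γ ᵥ* H⁻¹))} ⊆
      {γ : ℂ | ¬ (p - C γ * q).Separable} := by
    intro γ hγ hsep
    exact hγ (isDiagonalizableMat_companionMat _ (hpencil γ ▸ hsep))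
  exact ⟨hfin.subset hsub, (Set.ncard_le_ncard hsub hfin).trans hcard⟩
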